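/- Let C′, C, C″ be ℝ-graded vector spaces carrying differentials d_{C′}, d_C, d_{C″}, each of order (0,∞). Let b : C′ → C and c : C → C″ be chain maps (d_C∘b = b∘d_{C′} and d_{C″}∘c = c∘d_C), and let h : C′ → C″ satisfy c∘b = d_{C″}∘h + h∘d_{C′} (a homotopy between c∘b and 0). Assume there is ε > 0 such that: (i) C′ and C″ have gap (0,3ε), and C has gap (0,2ε); (ii) |r − s| ≥ 4ε for all r ∈ supp(C′) and s ∈ supp(C″); (iii) one can write b = β + (b − β) with β of order [0,ε) and b − β of order [2ε,∞), and c = γ + (c − γ) with γ of order [0,ε) and c − γ of order [2ε,∞), where moreover 0 → C′ →(β) C →(γ) C″ → 0 is a short exact sequence of vector spaces; (iv) h is of order [0,∞). Then the maps b*, c* induced on cohomology fit into an exact triangle: there exists a linear map ∂ : H(C″,d_{C″}) → H(C′,d_{C′}) with im(b*) = ker(c*), im(c*) = ker(∂), and im(∂) = ker(b*). -/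

import Mathlib

/-! Lemma 2.6.8 of Seidel, "A long exact sequence for symplectic Floer cohomology":
algebraic lemma producing a long exact sequence from low-order parts of chain maps
between ℝ-graded differential vector spaces over ℤ/2. -/

/-- Support of an ℝ-grading by submodules. -/
def GSupp {V : Type*} [AddCommGroup V] [Module (ZMod 2) V]
    (G : ℝ → Submodule (ZMod 2) V) : Set ℝ :=
  {r : ℝ | G r ≠ ⊥}

/-- The graded space has gap `I` if no two elements of the support differ by an element
of `I`. -/
def HasGap {V : Type*} [AddCommGroup V] [Module (ZMod 2) V]
    (G : ℝ → Submodule (ZMod 2) V) (I : Set ℝ) : Prop :=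
  ∀ r ∈ GSupp G, ∀ s ∈ GSupp G, r - s ∉ I

/-- A linear map between ℝ-graded vector spaces is of order `I` if it maps the piece of
degree `r` into the sum of the pieces of degrees `s ∈ r + I`. -/
def IsOrder {V W : Type*} [AddCommGroup V] [Module (ZMod 2) V]
    [AddCommGroup W] [Module (ZMod 2) W]
    (G : ℝ → Submodule (ZMod 2) V) (D : ℝ → Submodule (ZMod 2) W)
    (I : Set ℝ) (f : V →ₗ[ZMod 2] W) : Prop :=
  ∀ r : ℝ, ∀ x ∈ G r, f x ∈ ⨆ s ∈ {s : ℝ | s - r ∈ I}, D s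

/-- (Co)homology of a differential: `ker d / im d`. -/
abbrev Homology {V : Type*} [AddCommGroup V] [Module (ZMod 2) V]
    (d : V →ₗ[ZMod 2] V) :=
  LinearMap.ker d ⧸ (LinearMap.range d).comap (LinearMap.ker d).subtype

/-- The map induced on homology by a chain map. -/
noncomputable def inducedMap {V W : Type*} [AddCommGroup V] [Module (ZMod 2) V]
    [AddCommGroup W] [Module (ZMod 2) W]
    (dV : V →ₗ[ZMod 2] V) (dW : W →ₗ[ZMod 2] W)
    (f : V →ₗ[ZMod 2] W) (hf : dW ∘ₗ f = f ∘ₗ dV) :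
    Homology dV →ₗ[ZMod 2] Homology dW :=
  Submodule.mapQ _ _
    (f.restrict (p := LinearMap.ker dV) (q := LinearMap.ker dW)
      (fun x hx => by
        have h1 : dW (f x) = f (dV x) := LinearMap.congr_fun hf x
        simp only [LinearMap.mem_ker] at hx ⊢
        rw [h1, hx, map_zero]))
    (fun x hx => by
      simp only [Submodule.mem_comap, LinearMap.mem_range, Submodule.subtype_apply] at hx ⊢
      obtain ⟨y, hy⟩ := hx
      refine ⟨f y, ?_⟩
      have h1 : dW (f y) = f (dV y) := LinearMap.congr_fun hf y
      simp only [LinearMap.restrict_apply]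
      rw [h1, hy])

section HomologicalAlgebra

variable {C' C C'' : Type*}
  [AddCommGroup C'] [Module (ZMod 2) C'] [AddCommGroup C] [Module (ZMod 2) C]
  [AddCommGroup C''] [Module (ZMod 2) C'']

theorem add_self_eq_zero_of_module_zmod_two (v : C) : v + v = 0 := by
  rw [← two_smul (ZMod 2) v, show (2 : ZMod 2) = 0 from rfl, zero_smul]

theorem eq_of_add_eq_zero_of_module_zmod_two {v w : C} (hvw : v + w = 0) : v = w :=
  add_right_cancel (hvw.trans (add_self_eq_zero_of_module_zmod_two w).symm)

/-- A linear map whose kernel contains the kernel of a surjection factors through it. -/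
theorem LinearMap.exists_comp_eq_of_ker_le {K Z A B : Type*} [Field K]
    [AddCommGroup Z] [Module K Z] [AddCommGroup A] [Module K A] [AddCommGroup B] [Module K B]
    (f : Z →ₗ[K] A) (g : Z →ₗ[K] B) (hf : Function.Surjective f)
    (hker : LinearMap.ker f ≤ LinearMap.ker g) :
    ∃ u : A →ₗ[K] B, u ∘ₗ f = g := by
  obtain ⟨s, hs⟩ := f.exists_rightInverse_of_surjective (LinearMap.range_eq_top.2 hf)
  refine ⟨g ∘ₗ s, LinearMap.ext fun z => ?_⟩
  have hz : s (f z) - z ∈ LinearMap.ker f := by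
    simpa [sub_eq_zero] using LinearMap.congr_fun hs (f z)
  simpa [sub_eq_zero] using hker hz

/-- A differential on a finite-dimensional space is acyclic if it has a contracting homotopy up
to an invertible map. -/
theorem exists_eq_of_homotopy_surjective {K E : Type*} [Field K] [AddCommGroup E] [Module K E]
    [FiniteDimensional K E] (D κ : E →ₗ[K] E) (hD : D ∘ₗ D = 0)
    (hsurj : Function.Surjective (D ∘ₗ κ + κ ∘ₗ D)) (x : E) (hx : D x = 0) :
    ∃ y, D y = x := by
  have hinj := LinearMap.injective_iff_surjective.2 hsurj
  have hDD (v : E) : D (D v) = 0 := LinearMap.congr_fun hD v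
  obtain ⟨y, rfl⟩ := hsurj x
  have hy : D y = 0 := by
    apply hinj
    simpa [hDD] using hx
  exact ⟨κ y, by simp [hy]⟩

theorem Homology.mk_eq_zero_iff {d : C →ₗ[ZMod 2] C} (x : LinearMap.ker d) :
    (Submodule.Quotient.mk x : Homology d) = 0 ↔ ∃ y, d y = x := by
  rw [Submodule.Quotient.mk_eq_zero]
  rfl

theorem Homology.mk_eq_mk_iff {d : C →ₗ[ZMod 2] C} (x y : LinearMap.ker d) :
    (Submodule.Quotient.mk x : Homology d) = Submodule.Quotient.mk y ↔
      ∃ z, d z = (x : C) - y := by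
  rw [Submodule.Quotient.eq]
  rfl

/-- The differential of the twisted complex built from three complexes, two maps and a map
between the outer terms. -/
def twistedDifferential (d' : C' →ₗ[ZMod 2] C') (d : C →ₗ[ZMod 2] C) (d'' : C'' →ₗ[ZMod 2] C'')
    (b : C' →ₗ[ZMod 2] C) (c : C →ₗ[ZMod 2] C'') (h : C' →ₗ[ZMod 2] C'') :
    (C' × C × C'') →ₗ[ZMod 2] (C' × C × C'') where
  toFun v := (d' v.1, b v.1 + d v.2.1, h v.1 + c v.2.1 + d'' v.2.2)
  map_add' v w := by
    ext <;> simp <;> abel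
  map_smul' t v := by
    ext <;> simp

/-- If the twisted complex is acyclic, then its constituents form an exact triangle. -/
theorem exists_exact_triangle_of_acyclic
    (d' : C' →ₗ[ZMod 2] C') (d : C →ₗ[ZMod 2] C) (d'' : C'' →ₗ[ZMod 2] C'')
    (hd'sq : d' ∘ₗ d' = 0) (hdsq : d ∘ₗ d = 0) (hd''sq : d'' ∘ₗ d'' = 0)
    (b : C' →ₗ[ZMod 2] C) (c : C →ₗ[ZMod 2] C'')
    (hb : d ∘ₗ b = b ∘ₗ d') (hc : d'' ∘ₗ c = c ∘ₗ d)
    (h : C' →ₗ[ZMod 2] C'') (hh : c ∘ₗ b = d'' ∘ₗ h + h ∘ₗ d')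
    (hacyclic : ∀ v, twistedDifferential d' d d'' b c h v = 0 →
      ∃ w, twistedDifferential d' d d'' b c h w = v) :
    ∃ del : Homology d'' →ₗ[ZMod 2] Homology d',
      LinearMap.range (inducedMap d' d b hb) = LinearMap.ker (inducedMap d d'' c hc) ∧
      LinearMap.range (inducedMap d d'' c hc) = LinearMap.ker del ∧
      LinearMap.range del = LinearMap.ker (inducedMap d' d b hb) := by
  have hac : ∀ x y z, d' x = 0 → b x + d y = 0 → h x + c y + d'' z = 0 →
      ∃ x' y' z', d' x' = x ∧ b x' + d y' = y ∧ h x' + c y' + d'' z' = z := by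
    intro x y z hx hy hz
    obtain ⟨⟨x', y', z'⟩, hw⟩ := hacyclic (x, y, z) (by simp [twistedDifferential, hx, hy, hz])
    simp only [twistedDifferential, LinearMap.coe_mk, AddHom.coe_mk, Prod.mk.injEq] at hw
    exact ⟨x', y', z', hw⟩
  have hd'd' (x) : d' (d' x) = 0 := LinearMap.congr_fun hd'sq x
  have hdd (x) : d (d x) = 0 := LinearMap.congr_fun hdsq x
  have hd''d'' (x) : d'' (d'' x) = 0 := LinearMap.congr_fun hd''sq x
  have hdb (x) : d (b x) = b (d' x) := LinearMap.congr_fun hb x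
  have hdc (x) : d'' (c x) = c (d x) := LinearMap.congr_fun hc x
  have hcb (x) : c (b x) = d'' (h x) + h (d' x) := LinearMap.congr_fun hh x
  have add_self (v : C) : v + v = 0 := add_self_eq_zero_of_module_zmod_two v
  have add_self'' (v : C'') : v + v = 0 := add_self_eq_zero_of_module_zmod_two v
  -- Triples `(x, y, w)` with `x` a cycle whose image is bounded by `y`.
  let Z : Submodule (ZMod 2) (C' × C × C'') :=
    { carrier := {v | d' v.1 = 0 ∧ b v.1 + d v.2.1 = 0}
      zero_mem' := by simp
      add_mem' := by
        rintro v w ⟨hv, hv'⟩ ⟨hw, hw'⟩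
        refine ⟨by simp [hv, hw], ?_⟩
        rw [Prod.fst_add, Prod.snd_add, Prod.fst_add, map_add, map_add, add_add_add_comm, hv', hw',
          add_zero]
      smul_mem' := by
        rintro t v ⟨hv, hv'⟩
        refine ⟨by simp [hv], ?_⟩
        rw [Prod.smul_fst, Prod.smul_snd, Prod.smul_fst, map_smul, map_smul, ← smul_add, hv',
          smul_zero] }
  have hcyc (v : C' × C × C'') (hv : v ∈ Z) : d'' (h v.1 + c v.2.1 + d'' v.2.2) = 0 := by
    obtain ⟨hv1, hv2⟩ := hv
    have := congrArg c hv2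
    simp only [map_add, hcb, hv1, map_zero, add_zero] at this
    simp only [map_add, hdc, hd''d'', add_zero, this]
  let out : Z →ₗ[ZMod 2] LinearMap.ker d'' :=
    { toFun := fun v => ⟨h v.1.1 + c v.1.2.1 + d'' v.1.2.2, hcyc v v.2⟩
      map_add' := fun v w => by ext; simp; abel
      map_smul' := fun t v => by ext; simp }
  let inn : Z →ₗ[ZMod 2] LinearMap.ker d' :=
    { toFun := fun v => ⟨v.1.1, v.2.1⟩
      map_add' := fun v w => rfl
      map_smul' := fun t v => rfl }
  let f : Z →ₗ[ZMod 2] Homology d'' := Submodule.mkQ _ ∘ₗ out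
  let g : Z →ₗ[ZMod 2] Homology d' := Submodule.mkQ _ ∘ₗ inn
  have hf0 (v : Z) : f v = 0 ↔ ∃ w, d'' w = h v.1.1 + c v.1.2.1 + d'' v.1.2.2 :=
    Homology.mk_eq_zero_iff (out v)
  have hg0 (v : Z) : g v = 0 ↔ ∃ w, d' w = v.1.1 := Homology.mk_eq_zero_iff (inn v)
  have hf : Function.Surjective f := by
    intro z
    obtain ⟨⟨z, hz⟩, rfl⟩ := Submodule.Quotient.mk_surjective _ z
    obtain ⟨x, y, w, hx, hy, hw⟩ := hac 0 0 z (by simp) (by simp) (by simpa using hz)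
    exact ⟨⟨(x, y, w), hx, hy⟩,
      congrArg Submodule.Quotient.mk (Subtype.ext hw)⟩
  have hker : LinearMap.ker f ≤ LinearMap.ker g := by
    rintro ⟨⟨x, y, w⟩, hx, hy⟩ hv
    rw [LinearMap.mem_ker, hf0] at hv
    rw [LinearMap.mem_ker, hg0]
    obtain ⟨w', hw'⟩ := hv
    obtain ⟨x', y', z', hx', -, -⟩ := hac x y (w + w') hx hy (by
      rw [map_add, ← add_assoc, hw']
      exact add_self'' _)
    exact ⟨x', hx'⟩
  obtain ⟨del, hdel⟩ := f.exists_comp_eq_of_ker_le g hf hker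
  have hdel' (v : Z) : del (f v) = g v := LinearMap.congr_fun hdel v
  refine ⟨del, le_antisymm ?_ ?_, le_antisymm ?_ ?_, le_antisymm ?_ ?_⟩
  · rintro _ ⟨x, rfl⟩
    obtain ⟨⟨x, hx⟩, rfl⟩ := Submodule.Quotient.mk_surjective _ x
    refine (Homology.mk_eq_zero_iff _).2 ⟨h x, ?_⟩
    have := hcb x
    rw [LinearMap.mem_ker.1 hx, map_zero, add_zero] at this
    exact this.symm
  · intro y hy
    obtain ⟨⟨y, hdy⟩, rfl⟩ := Submodule.Quotient.mk_surjective _ y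
    obtain ⟨z, hz⟩ := (Homology.mk_eq_zero_iff _).1 hy
    replace hz : d'' z = c y := hz
    obtain ⟨x, y', w, hx, hy', -⟩ := hac 0 y z (by simp) (by simpa using hdy)
      (by rw [hz, map_zero, zero_add, add_self''])
    refine ⟨Submodule.Quotient.mk ⟨x, hx⟩, (Homology.mk_eq_mk_iff _ _).2 ⟨y', ?_⟩⟩
    change d y' = b x - y
    rw [← hy', sub_add_cancel_left]
    exact eq_neg_of_add_eq_zero_left (add_self _)
  · rintro _ ⟨y, rfl⟩
    obtain ⟨⟨y, hy⟩, rfl⟩ := Submodule.Quotient.mk_surjective _ y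
    let v : Z := ⟨(0, y, 0), by simp, by simpa using hy⟩
    have hv : f v = inducedMap d d'' c hc (Submodule.Quotient.mk ⟨y, hy⟩) := by
      refine congrArg Submodule.Quotient.mk (Subtype.ext ?_)
      change h 0 + c y + d'' 0 = c y
      simp
    rw [LinearMap.mem_ker, ← hv, hdel', hg0]
    exact ⟨0, map_zero _⟩
  · intro z hz
    obtain ⟨⟨⟨x, y, w⟩, hx, hy⟩, rfl⟩ := hf z
    rw [LinearMap.mem_ker, hdel', hg0] at hz
    obtain ⟨x', rfl⟩ := hz
    have hcycle : d (y + b x') = 0 := by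
      rw [map_add, hdb, add_comm]
      exact hy
    refine ⟨Submodule.Quotient.mk ⟨y + b x', hcycle⟩,
      (Homology.mk_eq_mk_iff _ _).2 ⟨h x' - w, ?_⟩⟩
    change d'' (h x' - w) = c (y + b x') - (h (d' x') + c y + d'' w)
    rw [map_sub, map_add, hcb]
    abel
  · rintro _ ⟨z, rfl⟩
    obtain ⟨⟨⟨x, y, w⟩, hx, hy⟩, rfl⟩ := hf z
    rw [hdel']
    exact (Homology.mk_eq_zero_iff _).2 ⟨y, (eq_of_add_eq_zero_of_module_zmod_two hy).symm⟩
  · intro x hx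
    obtain ⟨⟨x, hdx⟩, rfl⟩ := Submodule.Quotient.mk_surjective _ x
    obtain ⟨y, hy⟩ := (Homology.mk_eq_zero_iff _).1 hx
    replace hy : d y = b x := hy
    let v : Z := ⟨(x, y, 0), hdx, by rw [hy]; exact add_self _⟩
    exact ⟨f v, hdel' v⟩

end HomologicalAlgebra

section Order

variable {U V W : Type*} [AddCommGroup U] [Module (ZMod 2) U]
  [AddCommGroup V] [Module (ZMod 2) V] [AddCommGroup W] [Module (ZMod 2) W]
  {F : ℝ → Submodule (ZMod 2) U} {G : ℝ → Submodule (ZMod 2) V} {D : ℝ → Submodule (ZMod 2) W}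
  {I J K : Set ℝ}

theorem IsOrder.of_support {f : V →ₗ[ZMod 2] W} (hf : IsOrder G D I f)
    (hIJ : ∀ r ∈ GSupp G, ∀ s ∈ GSupp D, s - r ∈ I → s - r ∈ J) : IsOrder G D J f := by
  intro r x hx
  by_cases hr : G r = ⊥
  · obtain rfl : x = 0 := by simpa [hr] using hx
    simp
  refine (iSup₂_le fun s hs => ?_ : (⨆ s ∈ {s : ℝ | s - r ∈ I}, D s) ≤ _) (hf r x hx)
  by_cases hDs : D s = ⊥
  · simp [hDs]
  · exact le_iSup₂_of_le (f := fun s (_ : s ∈ {s : ℝ | s - r ∈ J}) => D s) s (hIJ r hr s hDs hs)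
      le_rfl

theorem IsOrder.mono {f : V →ₗ[ZMod 2] W} (hf : IsOrder G D I f) (hIJ : I ⊆ J) :
    IsOrder G D J f :=
  hf.of_support fun _ _ _ _ h => hIJ h

theorem IsOrder.add {f g : V →ₗ[ZMod 2] W} (hf : IsOrder G D I f) (hg : IsOrder G D I g) :
    IsOrder G D I (f + g) :=
  fun r x hx => add_mem (hf r x hx) (hg r x hx)

theorem IsOrder.sub {f g : V →ₗ[ZMod 2] W} (hf : IsOrder G D I f) (hg : IsOrder G D I g) :
    IsOrder G D I (f - g) :=
  fun r x hx => sub_mem (hf r x hx) (hg r x hx)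

theorem IsOrder.comp {f : U →ₗ[ZMod 2] V} {g : V →ₗ[ZMod 2] W} (hg : IsOrder G D J g)
    (hf : IsOrder F G I f) (hK : ∀ i ∈ I, ∀ j ∈ J, i + j ∈ K) : IsOrder F D K (g ∘ₗ f) := by
  intro r x hx
  refine (iSup₂_le fun s hs y hy => ?_ : (⨆ s ∈ {s : ℝ | s - r ∈ I}, G s) ≤
    (⨆ t ∈ {t : ℝ | t - r ∈ K}, D t).comap g) (hf r x hx)
  refine (iSup₂_le fun t ht => ?_ : (⨆ t ∈ {t : ℝ | t - s ∈ J}, D t) ≤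
    ⨆ t ∈ {t : ℝ | t - r ∈ K}, D t) (hg s y hy)
  refine le_iSup₂_of_le (f := fun t (_ : t ∈ {t : ℝ | t - r ∈ K}) => D t) t ?_ le_rfl
  have := hK _ hs _ ht
  rwa [add_comm, sub_add_sub_cancel] at this

theorem linearMap_ext_of_isInternal (hG : DirectSum.IsInternal G) {f g : V →ₗ[ZMod 2] W}
    (hfg : ∀ r, ∀ x ∈ G r, f x = g x) : f = g := by
  refine LinearMap.ext fun x => ?_
  have hx : x ∈ iSup G := by simp [hG.submodule_iSup_eq_top]
  exact (iSup_le fun r x hx => hfg r x hx : iSup G ≤ LinearMap.eqLocus f g) hx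

/-- A linear map on an internal direct sum may be prescribed on each summand. -/
theorem exists_linearMap_of_isInternal (hG : DirectSum.IsInternal G)
    (f : ℝ → V →ₗ[ZMod 2] W) : ∃ p : V →ₗ[ZMod 2] W, ∀ r, ∀ x ∈ G r, p x = f r x := by
  refine ⟨DirectSum.toModule (ZMod 2) ℝ W (fun r => f r ∘ₗ (G r).subtype) ∘ₗ
    (LinearEquiv.ofBijective (DirectSum.coeLinearMap G) hG).symm.toLinearMap, fun r x hx => ?_⟩
  have hof : (LinearEquiv.ofBijective (DirectSum.coeLinearMap G) hG).symm x =
      DirectSum.lof (ZMod 2) ℝ (fun r => G r) r ⟨x, hx⟩ := by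
    rw [LinearEquiv.symm_apply_eq]
    exact (DirectSum.coeLinearMap_lof G r ⟨x, hx⟩).symm
  simp [hof]

/-- The projection onto the part of a graded space with degrees in `A`. -/
theorem exists_graded_projection (hG : DirectSum.IsInternal G) (A : Set ℝ) :
    ∃ P : V →ₗ[ZMod 2] V, (∀ v, P v ∈ ⨆ r ∈ A, G r) ∧ (∀ r ∈ A, ∀ x ∈ G r, P x = x) ∧
      ∀ r ∉ A, ∀ x ∈ G r, P x = 0 := by
  classical
  obtain ⟨P, hP⟩ := exists_linearMap_of_isInternal hG
    fun r => if r ∈ A then (LinearMap.id : V →ₗ[ZMod 2] V) else 0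
  refine ⟨P, fun v => ?_, fun r hr x hx => by simp [hP r x hx, hr],
    fun r hr x hx => by simp [hP r x hx, hr]⟩
  have hv : v ∈ iSup G := by simp [hG.submodule_iSup_eq_top]
  refine (iSup_le fun r x hx => ?_ : iSup G ≤ (⨆ r ∈ A, G r).comap P) hv
  rw [Submodule.mem_comap, hP r x hx]
  split_ifs with hr
  · exact le_iSup₂_of_le (f := fun r (_ : r ∈ A) => G r) r hr le_rfl hx
  · simp

/-- An injective map of order `[0, ε)` out of a space with gap `(0, ε)` has a left inverse which
lowers degrees by less than `ε`. -/
theorem exists_order_leftInverse (hG : DirectSum.IsInternal G) (hD : DirectSum.IsInternal D)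
    {ε : ℝ} (hgap : HasGap G (Set.Ioo 0 ε)) (β : V →ₗ[ZMod 2] W)
    (hβ : IsOrder G D (Set.Ico 0 ε) β) (hinj : Function.Injective β) :
    ∃ p : W →ₗ[ZMod 2] V, IsOrder D G (Set.Ioi (-ε)) p ∧ ∀ x, p (β x) = x := by
  obtain ⟨p₀, hp₀⟩ := β.exists_leftInverse_of_injective (LinearMap.ker_eq_bot.2 hinj)
  choose P hPmem hPid hPzero using
    fun s : ℝ => exists_graded_projection hG {r : ℝ | r - s ∈ Set.Ioc (-ε) 0}
  obtain ⟨p, hp⟩ := exists_linearMap_of_isInternal hD fun s => P s ∘ₗ p₀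
  refine ⟨p, IsOrder.mono (I := Set.Ioc (-ε) 0) (fun s x hx => ?_) (fun t ht => ht.1), ?_⟩
  · rw [hp s x hx]
    exact hPmem s _
  refine LinearMap.congr_fun (linearMap_ext_of_isInternal hG (f := p ∘ₗ β) (g := LinearMap.id)
    fun r x hx => ?_)
  by_cases hr : G r = ⊥
  · obtain rfl : x = 0 := by simpa [hr] using hx
    simp
  obtain ⟨Q, -, hQid, hQzero⟩ := exists_graded_projection hG {r}
  have hPQ (s : ℝ) (hs : s - r ∈ Set.Ico 0 ε) : P s = Q := by
    refine linearMap_ext_of_isInternal hG fun t y hy => ?_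
    by_cases ht : G t = ⊥
    · obtain rfl : y = 0 := by simpa [ht] using hy
      simp
    by_cases htr : t = r
    · subst htr
      rw [hPid s t ⟨by linarith [hs.2], by linarith [hs.1]⟩ y hy, hQid t rfl y hy]
    · rw [hQzero t htr y hy, hPzero s t ?_ y hy]
      rintro ⟨h1, h2⟩
      rcases lt_or_gt_of_ne htr with hlt | hlt
      · exact hgap r hr t ht ⟨by linarith, by linarith [hs.1]⟩
      · exact hgap t ht r hr ⟨by linarith, by linarith [hs.2]⟩
  have key : β x ∈ LinearMap.eqLocus p (Q ∘ₗ p₀) := by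
    refine (iSup₂_le fun s hs y hy => ?_ : (⨆ s ∈ {s : ℝ | s - r ∈ Set.Ico 0 ε}, D s) ≤ _)
      (hβ r x hx)
    rw [LinearMap.mem_eqLocus, hp s y hy, hPQ s hs]
  have hpx : p (β x) = Q (p₀ (β x)) := key
  have hp₀x : p₀ (β x) = x := LinearMap.congr_fun hp₀ x
  rw [LinearMap.comp_apply, hpx, hp₀x, hQid r rfl x hx, LinearMap.id_apply]

/-- A surjective map of order `[0, ε)` onto a space with gap `(0, ε)` has a right inverse which
lowers degrees by less than `ε`. -/
theorem exists_order_rightInverse (hG : DirectSum.IsInternal G) (hD : DirectSum.IsInternal D)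
    {ε : ℝ} (hgap : HasGap D (Set.Ioo 0 ε)) (γ : V →ₗ[ZMod 2] W)
    (hγ : IsOrder G D (Set.Ico 0 ε) γ) (hsurj : Function.Surjective γ) :
    ∃ q : W →ₗ[ZMod 2] V, IsOrder D G (Set.Ioi (-ε)) q ∧ ∀ z, γ (q z) = z := by
  obtain ⟨q₀, hq₀⟩ := γ.exists_rightInverse_of_surjective (LinearMap.range_eq_top.2 hsurj)
  choose P hPmem hPid hPzero using
    fun t : ℝ => exists_graded_projection hG {s : ℝ | s - t ∈ Set.Ioc (-ε) 0}
  obtain ⟨q, hq⟩ := exists_linearMap_of_isInternal hD fun t => P t ∘ₗ q₀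
  refine ⟨q, IsOrder.mono (I := Set.Ioc (-ε) 0) (fun t z hz => ?_) (fun t ht => ht.1), ?_⟩
  · rw [hq t z hz]
    exact hPmem t _
  refine LinearMap.congr_fun (linearMap_ext_of_isInternal hD (f := γ ∘ₗ q) (g := LinearMap.id)
    fun t z hz => ?_)
  by_cases ht : D t = ⊥
  · obtain rfl : z = 0 := by simpa [ht] using hz
    simp
  obtain ⟨Q, -, hQid, hQzero⟩ := exists_graded_projection hD {t}
  have hγP : γ ∘ₗ P t = Q ∘ₗ γ := by
    refine linearMap_ext_of_isInternal hG fun s x hx => ?_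
    rw [LinearMap.comp_apply, LinearMap.comp_apply]
    by_cases hs : s - t ∈ Set.Ioc (-ε) 0
    · rw [hPid t s hs x hx]
      refine (iSup₂_le fun u hu y hy => ?_ : (⨆ u ∈ {u : ℝ | u - s ∈ Set.Ico 0 ε}, D u) ≤
        LinearMap.eqLocus LinearMap.id Q) (hγ s x hx)
      rw [LinearMap.mem_eqLocus, LinearMap.id_apply]
      by_cases hDu : D u = ⊥
      · obtain rfl : y = 0 := by simpa [hDu] using hy
        simp
      obtain rfl : u = t := by
        by_contra hut
        rcases lt_or_gt_of_ne hut with hlt | hlt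
        · exact hgap t ht u hDu ⟨by linarith, by linarith [hs.1, hu.1]⟩
        · exact hgap u hDu t ht ⟨by linarith, by linarith [hs.2, hu.2]⟩
      exact (hQid u rfl y hy).symm
    · rw [hPzero t s hs x hx, map_zero]
      refine (iSup₂_le fun u hu y hy => ?_ : (⨆ u ∈ {u : ℝ | u - s ∈ Set.Ico 0 ε}, D u) ≤
        LinearMap.eqLocus 0 Q) (hγ s x hx)
      rw [LinearMap.mem_eqLocus, LinearMap.zero_apply, hQzero u _ y hy]
      rintro rfl
      exact hs ⟨by linarith [hu.2], by linarith [hu.1]⟩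
  have hγz : γ (q₀ z) = z := LinearMap.congr_fun hq₀ z
  have := LinearMap.congr_fun hγP (q₀ z)
  simp only [LinearMap.comp_apply] at this ⊢
  rw [hq t z hz, LinearMap.comp_apply, this, hγz, hQid t rfl z hz, LinearMap.id_apply]

theorem IsOrder.apply_mem_of_forall_gt {f : V →ₗ[ZMod 2] W} (hf : IsOrder G D (Set.Ioi 0) f)
    {R : Submodule (ZMod 2) W} {r : ℝ} (hR : ∀ s, r < s → D s ≤ R) {x : V} (hx : x ∈ G r) :
    f x ∈ R :=
  (iSup₂_le fun s hs => hR s (sub_pos.1 hs) : (⨆ s ∈ {s : ℝ | s - r ∈ Set.Ioi 0}, D s) ≤ R)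
    (hf r x hx)

/-- Descending induction over the real line for a property that is automatic outside a finite
set. -/
theorem real_induction_of_finite {S : Set ℝ} (hS : S.Finite) {p : ℝ → Prop}
    (hp : ∀ r ∉ S, p r) (ih : ∀ r, (∀ s, r < s → p s) → p r) (r : ℝ) : p r := by
  by_cases hr : r ∈ S
  · refine (hS.wellFoundedOn (r := (· > ·))).induction hr fun y _ hy => ih y fun s hs => ?_
    by_cases hsS : s ∈ S
    · exact hy s hsS hs
    · exact hp s hsS
  · exact hp r hr

end Order

theorem low_energy_exact_triangle
    {C' C C'' : Type*}
    [AddCommGroup C'] [Module (ZMod 2) C'] [FiniteDimensional (ZMod 2) C']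
    [AddCommGroup C] [Module (ZMod 2) C] [FiniteDimensional (ZMod 2) C]
    [AddCommGroup C''] [Module (ZMod 2) C''] [FiniteDimensional (ZMod 2) C'']
    (G' : ℝ → Submodule (ZMod 2) C') (G : ℝ → Submodule (ZMod 2) C)
    (G'' : ℝ → Submodule (ZMod 2) C'')
    (hG' : DirectSum.IsInternal G') (hG : DirectSum.IsInternal G)
    (hG'' : DirectSum.IsInternal G'')
    (hfin' : (GSupp G').Finite) (hfin : (GSupp G).Finite) (hfin'' : (GSupp G'').Finite)
    (d' : C' →ₗ[ZMod 2] C') (d : C →ₗ[ZMod 2] C) (d'' : C'' →ₗ[ZMod 2] C'')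
    (hd'sq : d' ∘ₗ d' = 0) (hdsq : d ∘ₗ d = 0) (hd''sq : d'' ∘ₗ d'' = 0)
    (hd'ord : IsOrder G' G' (Set.Ioi 0) d')
    (hdord : IsOrder G G (Set.Ioi 0) d)
    (hd''ord : IsOrder G'' G'' (Set.Ioi 0) d'')
    (b : C' →ₗ[ZMod 2] C) (c : C →ₗ[ZMod 2] C'')
    (hb : d ∘ₗ b = b ∘ₗ d') (hc : d'' ∘ₗ c = c ∘ₗ d)
    (h : C' →ₗ[ZMod 2] C'')
    (hh : c ∘ₗ b = d'' ∘ₗ h + h ∘ₗ d')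
    (ε : ℝ) (hε : 0 < ε)
    (gap' : HasGap G' (Set.Ioo 0 (3*ε)))
    (gap'' : HasGap G'' (Set.Ioo 0 (3*ε)))
    (gap : HasGap G (Set.Ioo 0 (2*ε)))
    (hsep : ∀ r ∈ GSupp G', ∀ s ∈ GSupp G'', 4*ε ≤ |r - s|)
    (β : C' →ₗ[ZMod 2] C) (γ : C →ₗ[ZMod 2] C'')
    (hβ : IsOrder G' G (Set.Ico 0 ε) β)
    (hbβ : IsOrder G' G (Set.Ici (2*ε)) (b - β))
    (hγ : IsOrder G G'' (Set.Ico 0 ε) γ)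
    (hcγ : IsOrder G G'' (Set.Ici (2*ε)) (c - γ))
    (hβinj : Function.Injective β)
    (hexact : LinearMap.range β = LinearMap.ker γ)
    (hγsurj : Function.Surjective γ)
    (hord : IsOrder G' G'' (Set.Ici 0) h) :
    ∃ del : Homology d'' →ₗ[ZMod 2] Homology d',
      LinearMap.range (inducedMap d' d b hb) = LinearMap.ker (inducedMap d d'' c hc) ∧
      LinearMap.range (inducedMap d d'' c hc) = LinearMap.ker del ∧
      LinearMap.range del = LinearMap.ker (inducedMap d' d b hb) := by
  have hd'ord : IsOrder G' G' (Set.Ici (3 * ε)) d' := hd'ord.of_support fun r hr s hs hrs =>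
    not_lt.1 fun hlt => gap' s hs r hr ⟨hrs, hlt⟩
  have hdord : IsOrder G G (Set.Ici (2 * ε)) d := hdord.of_support fun r hr s hs hrs =>
    not_lt.1 fun hlt => gap s hs r hr ⟨hrs, hlt⟩
  have hd''ord : IsOrder G'' G'' (Set.Ici (3 * ε)) d'' := hd''ord.of_support fun r hr s hs hrs =>
    not_lt.1 fun hlt => gap'' s hs r hr ⟨hrs, hlt⟩
  have hord : IsOrder G' G'' (Set.Ici (4 * ε)) h := hord.of_support fun r hr s hs hrs => by
    have := hsep r hr s hs
    rwa [abs_sub_comm, abs_of_nonneg hrs] at this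
  obtain ⟨p, hpord, hpβ⟩ := exists_order_leftInverse hG' hG
    (fun r hr s hs hrs => gap' r hr s hs ⟨hrs.1, by linarith [hrs.2]⟩) β hβ hβinj
  obtain ⟨q₁, hq₁ord, hγq₁⟩ := exists_order_rightInverse hG hG''
    (fun r hr s hs hrs => gap'' r hr s hs ⟨hrs.1, by linarith [hrs.2]⟩) γ hγ hγsurj
  have hγβ (x) : γ (β x) = 0 := LinearMap.mem_ker.1 (hexact ▸ LinearMap.mem_range_self β x)
  let q : C'' →ₗ[ZMod 2] C := q₁ - (β ∘ₗ p) ∘ₗ q₁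
  have hqord : IsOrder G'' G (Set.Ioi (-(2 * ε))) q := by
    refine (hq₁ord.mono fun t ht => ?_).sub ((hβ.comp hpord (K := Set.Ioi (-ε)) ?_).comp hq₁ord ?_)
    · simp only [Set.mem_Ioi] at *; linarith
    · intro i hi j hj; simp only [Set.mem_Ioi, Set.mem_Ico] at *; linarith
    · intro i hi j hj; simp only [Set.mem_Ioi] at *; linarith
  have hγq (z) : γ (q z) = z := by simp [q, hγβ, hγq₁]
  have hqγ (y) : β (p y) + q (γ y) = y := by
    have hy : q₁ (γ y) - y ∈ LinearMap.range β := by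
      rw [hexact, LinearMap.mem_ker, map_sub, hγq₁, sub_self]
    obtain ⟨x, hx⟩ := hy
    have hq : q₁ (γ y) = β x + y := by rw [hx, sub_add_cancel]
    simp only [q, LinearMap.sub_apply, LinearMap.comp_apply, hq, map_add, hpβ]
    abel
  let D := twistedDifferential d' d d'' b c h
  let κ : (C' × C × C'') →ₗ[ZMod 2] (C' × C × C'') :=
    { toFun := fun v => (p v.2.1, q v.2.2, 0)
      map_add' := fun v w => by ext <;> simp
      map_smul' := fun t v => by ext <;> simp }
  have hDD : D ∘ₗ D = 0 := by
    refine LinearMap.ext fun ⟨x, y, z⟩ => Prod.ext ?_ (Prod.ext ?_ ?_)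
    · exact LinearMap.congr_fun hd'sq x
    · change b (d' x) + d (b x + d y) = 0
      have hdb : d (b x) = b (d' x) := LinearMap.congr_fun hb x
      have hdd : d (d y) = 0 := LinearMap.congr_fun hdsq y
      rw [map_add, hdb, hdd, add_zero, add_self_eq_zero_of_module_zmod_two]
    · change h (d' x) + c (b x + d y) + d'' (h x + c y + d'' z) = 0
      have hdc : d'' (c y) = c (d y) := LinearMap.congr_fun hc y
      have hcb : c (b x) = d'' (h x) + h (d' x) := LinearMap.congr_fun hh x
      have hdd : d'' (d'' z) = 0 := LinearMap.congr_fun hd''sq z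
      rw [map_add, map_add, map_add, hcb, hdc, hdd]
      refine Eq.trans ?_
        (add_self_eq_zero_of_module_zmod_two (h (d' x) + d'' (h x) + c (d y)))
      abel
  refine exists_exact_triangle_of_acyclic d' d d'' hd'sq hdsq hd''sq b c hb hc h hh
    (exists_eq_of_homotopy_surjective D κ hDD ?_)
  rw [← LinearMap.range_eq_top]
  set R := LinearMap.range (D ∘ₗ κ + κ ∘ₗ D)
  let i' : C' →ₗ[ZMod 2] C' × C × C'' := LinearMap.inl _ _ _
  let i : C →ₗ[ZMod 2] C' × C × C'' := LinearMap.inr _ _ _ ∘ₗ LinearMap.inl _ _ _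
  let i'' : C'' →ₗ[ZMod 2] C' × C × C'' := LinearMap.inr _ _ _ ∘ₗ LinearMap.inr _ _ _
  have hR (r : ℝ) : G' r ≤ R.comap i' ∧ G r ≤ R.comap i ∧ G'' r ≤ R.comap i'' := by
    refine real_induction_of_finite
      (p := fun r => G' r ≤ R.comap i' ∧ G r ≤ R.comap i ∧ G'' r ≤ R.comap i'')
      ((hfin'.union hfin).union hfin'') (fun r hr => ?_)
      (fun r ih => ?_) r
    · simp only [GSupp, Set.mem_union, Set.mem_ofPred_eq, not_or, not_not] at hr
      simp [hr]
    have ih' (s) (hs : r < s) := (ih s hs).1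
    have ih₀ (s) (hs : r < s) := (ih s hs).2.1
    have ih'' (s) (hs : r < s) := (ih s hs).2.2
    refine ⟨fun x hx => ?_, fun y hy => ?_, fun z hz => ?_⟩
    · have h1 : IsOrder G' G' (Set.Ioi 0) (p ∘ₗ (b - β)) := hpord.comp hbβ fun u hu v hv => by
        simp only [Set.mem_Ioi, Set.mem_Ici] at *; linarith
      have h2 : IsOrder G' G (Set.Ioi 0) (q ∘ₗ h) := hqord.comp hord fun u hu v hv => by
        simp only [Set.mem_Ioi, Set.mem_Ici] at *; linarith
      have hT : i' x = (D ∘ₗ κ + κ ∘ₗ D) (i' x) - i' ((p ∘ₗ (b - β)) x) - i ((q ∘ₗ h) x) := by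
        simp [D, κ, i', i, twistedDifferential, hpβ]
      rw [Submodule.mem_comap, hT]
      exact sub_mem (sub_mem (LinearMap.mem_range_self _ _) (h1.apply_mem_of_forall_gt ih' hx))
        (h2.apply_mem_of_forall_gt ih₀ hx)
    · have h1 : IsOrder G G' (Set.Ioi 0) (d' ∘ₗ p + p ∘ₗ d) := by
        refine (hd'ord.comp hpord ?_).add (hpord.comp hdord ?_) <;> intro u hu v hv <;>
          simp only [Set.mem_Ioi, Set.mem_Ici] at * <;> linarith
      have h2 : IsOrder G G (Set.Ioi 0) ((b - β) ∘ₗ p + q ∘ₗ (c - γ)) := by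
        refine (hbβ.comp hpord ?_).add (hqord.comp hcγ ?_) <;> intro u hu v hv <;>
          simp only [Set.mem_Ioi, Set.mem_Ici] at * <;> linarith
      have h3 : IsOrder G G'' (Set.Ioi 0) (h ∘ₗ p) := hord.comp hpord fun u hu v hv => by
        simp only [Set.mem_Ioi, Set.mem_Ici] at *; linarith
      have hT : i y = (D ∘ₗ κ + κ ∘ₗ D) (i y) - i' ((d' ∘ₗ p + p ∘ₗ d) y) -
          i (((b - β) ∘ₗ p + q ∘ₗ (c - γ)) y) - i'' ((h ∘ₗ p) y) := by
        simp [D, κ, i', i, i'', twistedDifferential]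
        nth_rewrite 1 [← hqγ y]
        abel
      rw [Submodule.mem_comap, hT]
      exact sub_mem (sub_mem (sub_mem (LinearMap.mem_range_self _ _)
        (h1.apply_mem_of_forall_gt ih' hy)) (h2.apply_mem_of_forall_gt ih₀ hy))
        (h3.apply_mem_of_forall_gt ih'' hy)
    · have h1 : IsOrder G'' G (Set.Ioi 0) (d ∘ₗ q + q ∘ₗ d'') := by
        refine (hdord.comp hqord ?_).add (hqord.comp hd''ord ?_) <;> intro u hu v hv <;>
          simp only [Set.mem_Ioi, Set.mem_Ici] at * <;> linarith
      have h2 : IsOrder G'' G'' (Set.Ioi 0) ((c - γ) ∘ₗ q) := hcγ.comp hqord fun u hu v hv => by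
        simp only [Set.mem_Ioi, Set.mem_Ici] at *; linarith
      have hT : i'' z = (D ∘ₗ κ + κ ∘ₗ D) (i'' z) - i ((d ∘ₗ q + q ∘ₗ d'') z) -
          i'' (((c - γ) ∘ₗ q) z) := by
        simp [D, κ, i'', i, twistedDifferential, hγq]
      rw [Submodule.mem_comap, hT]
      exact sub_mem (sub_mem (LinearMap.mem_range_self _ _) (h1.apply_mem_of_forall_gt ih₀ hz))
        (h2.apply_mem_of_forall_gt ih'' hz)
  refine top_unique fun v _ => ?_
  have hv' : v.1 ∈ iSup G' := by simp [hG'.submodule_iSup_eq_top]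
  have hv : v.2.1 ∈ iSup G := by simp [hG.submodule_iSup_eq_top]
  have hv'' : v.2.2 ∈ iSup G'' := by simp [hG''.submodule_iSup_eq_top]
  have hsum : v = i' v.1 + i v.2.1 + i'' v.2.2 := by
    ext <;> simp [i', i, i'']
  rw [hsum]
  exact add_mem (add_mem (iSup_le (fun r => (hR r).1) hv') (iSup_le (fun r => (hR r).2.1) hv))
    (iSup_le (fun r => (hR r).2.2) hv'')
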